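/- arXiv:2201.00864 — 3 statements merged into one kernel-verified Lean document; each statement's English description precedes it below -/
import Mathlib

section
/- For every g ≥ 1, the simple graph on ZMod g × ZMod g in which two distinct vertices u and v are adjacent if and only if u.1 = v.1 or u.1 + u.2 = v.1 + v.2 is connected. -/
/-- The row/diagonal graph on `ZMod g × ZMod g` is connected: two distinct
vertices are adjacent iff they share the same first coordinate or the same
sum of coordinates. -/
theorem grid_row_diag_connected (g : ℕ) (hg : 1 ≤ g) :
    (SimpleGraph.fromRel
      (fun u v : ZMod g × ZMod g =>
        u.1 = v.1 ∨ u.1 + u.2 = v.1 + v.2)).Connected := by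
  have key : ∀ u v : ZMod g × ZMod g, (u.1 = v.1 ∨ u.1 + u.2 = v.1 + v.2) →
      (SimpleGraph.fromRel
        (fun u v : ZMod g × ZMod g =>
          u.1 = v.1 ∨ u.1 + u.2 = v.1 + v.2)).Reachable u v := by
    intro u v h
    by_cases huv : u = v
    · subst huv
      exact SimpleGraph.Reachable.refl _
    · apply SimpleGraph.Adj.reachable
      rw [SimpleGraph.fromRel_adj]
      exact ⟨huv, Or.inl h⟩
  haveI : Nonempty (ZMod g × ZMod g) := ⟨(0, 0)⟩
  refine SimpleGraph.Connected.mk ?_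
  intro u v
  refine (key u (u.1, v.1 + v.2 - u.1) (Or.inl rfl)).trans (key _ v (Or.inr ?_))
  simp
end

section
/- Let F be a field, n ≥ 1 the number of parties, m ≥ 1 the number of shards, and t ≥ 1 the group threshold. For each party j let q_j be a polynomial over F with q_j.degree < m and secret v_j = (q_j).eval 0, and let z : Fin m → F be an injective family of nonzero shard-evaluation points. For each round r : Fin m, let grp_r : Fin n → ι_r be an assignment of parties to groups, and for each party j let p_{j,r} be a polynomial over F with (p_{j,r}).degree < t and (p_{j,r}).eval 0 = (q_j).eval (z r). Fix for each group an injective family x : Fin t → F of evaluation points. Define, for each group G in round r, its reconstructed output as the value at 0 of the Lagrange interpolation through the nodes x with values i ↦ Σ_{j ∈ G} (p_{j,r}).eval (x i), and define S_r as the sum of the reconstructed outputs over all groups of round r. Then the value at 0 of the Lagrange interpolation through the nodes z with values r ↦ S_r equals Σ_j v_j. -/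
theorem interp_sum_aux {F : Type*} [Field F] {κ : Type*} (k : ℕ) (s : Finset κ)
    (f : κ → Polynomial F) (hf : ∀ j, (f j).degree < k)
    (x : Fin k → F) (hx : Function.Injective x) :
    (Lagrange.interpolate Finset.univ x (fun i => ∑ j ∈ s, (f j).eval (x i))).eval 0
      = ∑ j ∈ s, (f j).eval 0 := by
  have hd : (∑ j ∈ s, f j).degree < ((Finset.univ : Finset (Fin k)).card : WithBot ℕ) := by
    rw [Finset.card_univ, Fintype.card_fin]
    refine lt_of_le_of_lt (Polynomial.degree_sum_le _ _) ?_
    refine (Finset.sup_lt_iff (WithBot.bot_lt_coe k)).2 ?_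
    exact fun j _ => hf j
  rw [← Lagrange.eq_interpolate_of_eval_eq _ hx.injOn hd
    (fun i _ => Polynomial.eval_finsetSum _ _ _), Polynomial.eval_finsetSum]

/-- Honest-execution correctness of SHARD: reconstructing (by Lagrange
interpolation at `0` through the shard points) from the round sums `S r`,
where each round sum is the sum over groups of the group-level reconstructed
shard sums, yields the sum of all parties' secrets. -/
theorem shard_correct {F : Type*} [Field F] {ι : Type*} [DecidableEq ι]
    (n m t : ℕ) (hn : 1 ≤ n) (hm : 1 ≤ m) (ht : 1 ≤ t)
    (q : Fin n → Polynomial F) (hq : ∀ j, (q j).degree < m)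
    (z : Fin m → F) (hz : Function.Injective z) (hz0 : ∀ r, z r ≠ 0)
    (grp : Fin m → Fin n → ι)
    (p : Fin n → Fin m → Polynomial F)
    (hpdeg : ∀ j r, (p j r).degree < t)
    (hpsec : ∀ j r, (p j r).eval 0 = (q j).eval (z r))
    (x : Fin t → F) (hx : Function.Injective x) :
    (Lagrange.interpolate Finset.univ z
        (fun r =>
          ∑ c ∈ Finset.univ.image (grp r),
            (Lagrange.interpolate Finset.univ x
              (fun i =>
                ∑ j ∈ Finset.univ.filter (fun j => grp r j = c),
                  (p j r).eval (x i))).eval 0)).eval 0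
      = ∑ j : Fin n, (q j).eval 0 := by
  have key : ∀ r : Fin m, (∑ c ∈ Finset.univ.image (grp r),
            (Lagrange.interpolate Finset.univ x
              (fun i =>
                ∑ j ∈ Finset.univ.filter (fun j => grp r j = c),
                  (p j r).eval (x i))).eval 0) = ∑ j : Fin n, (q j).eval (z r) := by
    intro r
    rw [Finset.sum_congr rfl (fun c _ =>
      interp_sum_aux t _ (fun j => p j r) (fun j => hpdeg j r) x hx)]
    rw [Finset.sum_fiberwise_of_maps_to
      (fun j _ => Finset.mem_image_of_mem (grp r) (Finset.mem_univ j))]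
    exact Finset.sum_congr rfl (fun j _ => hpsec j r)
  simp only [key]
  exact interp_sum_aux m Finset.univ q hq z hz
end

section
/- Let F be a field, let z₁ ≠ z₂ be two points of F, and let G₁, G₂, G₃, G₄ be finite sets of parties with G₁ and G₂ disjoint, G₃ and G₄ disjoint, and G₁ ∪ G₂ = G₃ ∪ G₄. For each party j in G₁ ∪ G₂ let q_j be a polynomial over F with q_j.degree < 2 and secret v_j = (q_j).eval 0. Then the value at 0 of the Lagrange interpolation through the two nodes z₁, z₂ with values (Σ_{j ∈ G₁} (q_j).eval z₁) + (Σ_{j ∈ G₂} (q_j).eval z₁) and (Σ_{j ∈ G₃} (q_j).eval z₂) + (Σ_{j ∈ G₄} (q_j).eval z₂) respectively equals Σ_{j ∈ G₁ ∪ G₂} v_j. -/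
/-- Disjointness of the two rounds' group collections is insufficient: if the
round-1 groups `G₁, G₂` cover exactly the same parties as the round-2 groups
`G₃, G₄`, the four group outputs reconstruct the subset sum of `G₁ ∪ G₂`. -/
theorem covering_groups_leak_sum {F : Type*} [Field F] {ι : Type*}
    [DecidableEq ι]
    (z₁ z₂ : F) (hz : z₁ ≠ z₂) (G₁ G₂ G₃ G₄ : Finset ι)
    (h12 : Disjoint G₁ G₂) (h34 : Disjoint G₃ G₄)
    (hcover : G₁ ∪ G₂ = G₃ ∪ G₄)
    (q : ι → Polynomial F) (hq : ∀ j ∈ G₁ ∪ G₂, (q j).degree < 2) :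
    (Lagrange.interpolate Finset.univ (![z₁, z₂])
        (![(∑ j ∈ G₁, (q j).eval z₁) + (∑ j ∈ G₂, (q j).eval z₁),
           (∑ j ∈ G₃, (q j).eval z₂) + (∑ j ∈ G₄, (q j).eval z₂)])).eval 0
      = ∑ j ∈ G₁ ∪ G₂, (q j).eval 0 := by
  rw [← Finset.sum_union h12, ← Finset.sum_union h34, ← hcover]
  rw [← Lagrange.eq_interpolate_of_eval_eq (f := ∑ j ∈ G₁ ∪ G₂, q j)]
  · rw [Polynomial.eval_finset_sum]
  · intro a _ b _ hab
    fin_cases a <;> fin_cases b <;> simp_all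
  · have h : (∑ j ∈ G₁ ∪ G₂, q j) ∈ Polynomial.degreeLT F 2 :=
      Submodule.sum_mem _ fun j hj => Polynomial.mem_degreeLT.2 (hq j hj)
    simpa using Polynomial.mem_degreeLT.1 h
  · intro i _
    fin_cases i <;> simp [Polynomial.eval_finset_sum]
end
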